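/- Let f = (f_1,…,f_n) be polynomials in R[x] with each deg f_i ≥ 1, δ_f = Σ_{i=1}^n (deg f_i − 1), and let δ_1, δ_2 ≥ 0 be integers. For i = 1,2 let L_i be an R-linear functional on R[x] that annuls (f)^{≤δ_f+δ_i}_x. Fix monotonous difference derivatives ∇f_i of the f_i. Then for every F ∈ (f)^{≤δ_f+δ_1+δ_2+1}_x and every monotonous difference derivative ∇F of F, one has L_1(x_*).( L_2(y_*).det‖∇f(x,y) ∇F(x,y); f(x) F(x)‖ ) = 0. In other words, the functional L defined by L.F = L_1(x_*).(L_2(y_*).det‖∇f ∇F; f(x) F(x)‖) annuls (f)^{≤δ_f+δ_1+δ_2+1}_x. -/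

import Mathlib

open MvPolynomial Finset

noncomputable section

variable {R : Type*} [CommRing R] {n : ℕ}

/-- Total degree of a multivariate polynomial, valued in `WithBot ℤ`,
with the convention `deg 0 = ⊥` (i.e. `-∞`). -/
def mdeg {σ S : Type*} [CommSemiring S] (F : MvPolynomial σ S) : WithBot ℤ :=
  F.support.sup fun m => ((m.sum fun _ e => e : ℕ) : ℤ)

/-- The embedding `R[x] → R[x,y]`, `x_i ↦ x_i` (the x-variables are `Sum.inl`,
the y-variables are `Sum.inr`). -/
def toX : MvPolynomial (Fin n) R →ₐ[R] MvPolynomial (Fin n ⊕ Fin n) R :=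
  rename Sum.inl

/-- The embedding `R[x] → R[x,y]`, `x_i ↦ y_i`. -/
def toY : MvPolynomial (Fin n) R →ₐ[R] MvPolynomial (Fin n ⊕ Fin n) R :=
  rename Sum.inr

/-- `D = (∇¹F, …, ∇ⁿF)` is a difference derivative of `F`:
`∑ k, (x_k - y_k) * ∇ᵏF(x,y) = F(x) - F(y)`. -/
def IsDiffDeriv (F : MvPolynomial (Fin n) R)
    (D : Fin n → MvPolynomial (Fin n ⊕ Fin n) R) : Prop :=
  ∑ k : Fin n, (X (Sum.inl k) - X (Sum.inr k)) * D k = toX F - toY F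

/-- A difference derivative of `F` is monotonous if each component has total degree
`≤ deg F - 1` (equivalently `deg (∇ᵏF) + 1 ≤ deg F` in `WithBot ℤ`). -/
def IsMonotonous (F : MvPolynomial (Fin n) R)
    (D : Fin n → MvPolynomial (Fin n ⊕ Fin n) R) : Prop :=
  ∀ k, mdeg (D k) + 1 ≤ mdeg F

/-- `δ_f = ∑ᵢ (deg fᵢ - 1)`. -/
def deltaF (f : Fin n → MvPolynomial (Fin n) R) : ℤ :=
  ∑ i, (((f i).totalDegree : ℤ) - 1)

/-- `(f)^{≤ d}_x`: sums `∑ fᵢ gᵢ` with `deg fᵢ + deg gᵢ ≤ d` for every `i`. -/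
def boundedSpan (f : Fin n → MvPolynomial (Fin n) R) (d : WithBot ℤ) :
    Set (MvPolynomial (Fin n) R) :=
  {F | ∃ g : Fin n → MvPolynomial (Fin n) R,
    F = ∑ i, f i * g i ∧ ∀ i, mdeg (f i) + mdeg (g i) ≤ d}

/-- A linear functional `L` annuls a set `S` if it vanishes on it. -/
def Annuls (L : MvPolynomial (Fin n) R →ₗ[R] R) (S : Set (MvPolynomial (Fin n) R)) : Prop :=
  ∀ F ∈ S, L F = 0

/-- `L(y_*).P` : apply the functional `L` to the `y`-part of `P ∈ R[x,y]`,
i.e. if `P = ∑_α A_α(x) y^α` then `L(y_*).P = ∑_α L(y^α) • A_α(x)`. -/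
def applyY (L : MvPolynomial (Fin n) R →ₗ[R] R) (P : MvPolynomial (Fin n ⊕ Fin n) R) :
    MvPolynomial (Fin n) R :=
  ∑ m ∈ P.support,
    C (L (monomial (Finsupp.sumFinsuppAddEquivProdFinsupp m).2 (1 : R)) * P.coeff m) *
      monomial (Finsupp.sumFinsuppAddEquivProdFinsupp m).1 (1 : R)

/-- `det‖∇f(x,y) ∇F(x,y); f(x) F(x)‖` : the `(n+1) × (n+1)` determinant whose entry `(k,i)`
is `∇ᵏfᵢ(x,y)` for `k, i ≤ n`, entry `(k, n+1)` is `∇ᵏF(x,y)`, entry `(n+1, i)` is `fᵢ(x)`,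
and entry `(n+1, n+1)` is `F(x)`.  Here `Df i` is the tuple `(∇¹fᵢ, …, ∇ⁿfᵢ)`. -/
def ddetX (f : Fin n → MvPolynomial (Fin n) R)
    (Df : Fin n → Fin n → MvPolynomial (Fin n ⊕ Fin n) R)
    (F : MvPolynomial (Fin n) R) (DF : Fin n → MvPolynomial (Fin n ⊕ Fin n) R) :
    MvPolynomial (Fin n ⊕ Fin n) R :=
  Matrix.det (Matrix.of fun k i : Fin (n + 1) =>
    if hk : (k : ℕ) < n then
      if hi : (i : ℕ) < n then Df ⟨i, hi⟩ ⟨k, hk⟩ else DF ⟨k, hk⟩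
    else
      if hi : (i : ℕ) < n then toX (f ⟨i, hi⟩) else toX F)

/-- `det‖∇f(x,y) ∇F(x,y); f(y) F(y)‖` : as `ddetX` but with last row `(f₁(y),…,fₙ(y),F(y))`. -/
def ddetY (f : Fin n → MvPolynomial (Fin n) R)
    (Df : Fin n → Fin n → MvPolynomial (Fin n ⊕ Fin n) R)
    (F : MvPolynomial (Fin n) R) (DF : Fin n → MvPolynomial (Fin n ⊕ Fin n) R) :
    MvPolynomial (Fin n ⊕ Fin n) R :=
  Matrix.det (Matrix.of fun k i : Fin (n + 1) =>
    if hk : (k : ℕ) < n then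
      if hi : (i : ℕ) < n then Df ⟨i, hi⟩ ⟨k, hk⟩ else DF ⟨k, hk⟩
    else
      if hi : (i : ℕ) < n then toY (f ⟨i, hi⟩) else toY F)

section helpers
variable {σ τ : Type*}

/-- Degree bound predicate with integer bounds. -/
def DL (p : MvPolynomial σ R) (e : ℤ) : Prop :=
  ∀ m, coeff m p ≠ 0 → ((Finsupp.degree m : ℕ) : ℤ) ≤ e

lemma DL.mono {p : MvPolynomial σ R} {e e' : ℤ} (h : DL p e) (he : e ≤ e') : DL p e' :=
  fun m hm => (h m hm).trans he

lemma DL_zero (e : ℤ) : DL (0 : MvPolynomial σ R) e := fun m hm => by simp at hm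

lemma DL.add {p q : MvPolynomial σ R} {e : ℤ} (hp : DL p e) (hq : DL q e) : DL (p + q) e := by
  intro m hm
  by_cases h : coeff m p = 0
  · refine hq m fun h' => hm ?_
    simp [h, h']
  · exact hp m h

lemma DL.neg {p : MvPolynomial σ R} {e : ℤ} (hp : DL p e) : DL (-p) e := by
  intro m hm
  exact hp m (by simpa using hm)

lemma DL.sub {p q : MvPolynomial σ R} {e : ℤ} (hp : DL p e) (hq : DL q e) : DL (p - q) e := by
  rw [sub_eq_add_neg]; exact hp.add hq.neg

lemma DL.mul {p q : MvPolynomial σ R} {e e' : ℤ} (hp : DL p e) (hq : DL q e') :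
    DL (p * q) (e + e') := by
  classical
  intro m hm
  rw [coeff_mul] at hm
  obtain ⟨⟨a, b⟩, hab, hne⟩ := Finset.exists_ne_zero_of_sum_ne_zero hm
  have h1 := hp a (left_ne_zero_of_mul hne)
  have h2 := hq b (right_ne_zero_of_mul hne)
  rw [Finset.HasAntidiagonal.mem_antidiagonal] at hab
  rw [← hab, map_add]
  push_cast
  exact add_le_add h1 h2

lemma DL_sum {ι : Type*} (s : Finset ι) (p : ι → MvPolynomial σ R) (e : ℤ)
    (h : ∀ i ∈ s, DL (p i) e) : DL (∑ i ∈ s, p i) e :=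
  Finset.sum_induction p (fun q => DL q e) (fun _ _ => DL.add) (DL_zero e) h

lemma DL_C (a : R) : DL (C a : MvPolynomial σ R) 0 := by
  classical
  intro m hm
  rw [coeff_C] at hm
  have : 0 = m := by by_contra h; simp [h] at hm
  simp [← this]

lemma DL_one : DL (1 : MvPolynomial σ R) 0 := by
  rw [← C_1]; exact DL_C 1

lemma DL_prod {ι : Type*} (s : Finset ι) (p : ι → MvPolynomial σ R) (e : ι → ℤ)
    (h : ∀ i ∈ s, DL (p i) (e i)) : DL (∏ i ∈ s, p i) (∑ i ∈ s, e i) := by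
  classical
  induction s using Finset.induction_on with
  | empty => simpa using DL_one
  | insert a s ha ih =>
    rw [Finset.prod_insert ha, Finset.sum_insert ha]
    exact (h a (by simp)).mul (ih fun i hi => h i (by simp [hi]))

lemma DL_X (i : σ) : DL (X i : MvPolynomial σ R) 1 := by
  classical
  intro m hm
  rw [coeff_X] at hm
  have : Finsupp.single i 1 = m := by by_contra h; simp [h] at hm
  simp [← this]

lemma mdeg_le_iff (p : MvPolynomial σ R) (e : ℤ) : mdeg p ≤ (e : WithBot ℤ) ↔ DL p e := by
  unfold mdeg DL
  rw [Finset.sup_le_iff]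
  simp only [mem_support_iff]
  refine forall_congr' fun m => imp_congr_right fun _ => ?_
  exact WithBot.coe_le_coe

lemma DL_totalDegree (p : MvPolynomial σ R) : DL p (p.totalDegree : ℤ) := by
  intro m hm
  have := le_totalDegree (p := p) (s := m) (by simpa using hm)
  exact_mod_cast this

lemma mdeg_eq {p : MvPolynomial σ R} (hp : p ≠ 0) :
    mdeg p = (((p.totalDegree : ℕ) : ℤ) : WithBot ℤ) := by
  apply le_antisymm
  · rw [mdeg_le_iff]; exact DL_totalDegree p
  · obtain ⟨m, hm, h⟩ := Finset.exists_mem_eq_sup p.support (support_nonempty.mpr hp)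
      (fun m => m.sum fun _ e => e)
    have h' : p.totalDegree = (m.sum fun _ e => e) := h
    rw [h']
    exact Finset.le_sup (f := fun m : σ →₀ ℕ => (((m.sum fun _ e => e : ℕ) : ℤ) : WithBot ℤ)) hm

lemma DL_induct {P : MvPolynomial σ R → ℤ → Prop} (h0 : ∀ e, P 0 e)
    (hadd : ∀ p q e, P p e → P q e → P (p + q) e) (hC : ∀ a e, 0 ≤ e → P (C a) e)
    (hX : ∀ p i e, DL p (e - 1) → P p (e - 1) → P (p * X i) e)
    {p : MvPolynomial σ R} {e : ℤ} (hp : DL p e) : P p e := by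
  classical
  have key : ∀ (s : σ →₀ ℕ) (a : R), ∀ e, DL (monomial s a) e → P (monomial s a) e := by
    intro s a
    refine induction_on_monomial (motive := fun p => ∀ e, DL p e → P p e) ?_ ?_ s a
    · intro a e h
      by_cases ha : a = 0
      · rw [ha, C_0]; exact h0 e
      · refine hC a e ?_
        simpa using h 0 (by simpa using ha)
    · intro p i ih e h
      have h1 : DL p (e - 1) := by
        intro m hm
        have := h (m + Finsupp.single i 1) (by rwa [coeff_mul_X])
        rw [map_add] at this
        simp at this
        omega
      exact hX p i e h1 (ih _ h1)
  rw [p.as_sum]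
  refine Finset.sum_induction _ (fun q => P q e) (fun p q => hadd p q e) (h0 e) ?_
  intro v hv
  apply key
  intro m hm
  rw [coeff_monomial] at hm
  have : v = m := by by_contra h; simp [h] at hm
  subst this
  exact hp v (by simpa using hv)

lemma DL_hom (φ : MvPolynomial σ R →ₐ[R] MvPolynomial τ R) (hφ : ∀ i, DL (φ (X i)) 1)
    {p : MvPolynomial σ R} {e : ℤ} (hp : DL p e) : DL (φ p) e := by
  refine DL_induct (P := fun p e => DL (φ p) e) ?_ ?_ ?_ ?_ hp
  · intro e; simpa using DL_zero e
  · intro p q e h1 h2; rw [map_add]; exact h1.add h2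
  · intro a e he
    have : φ (C a) = C a := φ.commutes a
    rw [this]; exact (DL_C a).mono he
  · intro p i e _ h
    rw [map_mul]
    exact (h.mul (hφ i)).mono (by omega)

/-- General telescoping. -/
lemma exists_diff [Fintype σ] (φ ψ : MvPolynomial σ R →ₐ[R] MvPolynomial τ R)
    (hφ : ∀ i, DL (φ (X i)) 1) (hψ : ∀ i, DL (ψ (X i)) 1)
    {p : MvPolynomial σ R} {e : ℤ} (hp : DL p e) :
    ∃ D : σ → MvPolynomial τ R, (∀ i, DL (D i) (e - 1)) ∧
      ∑ i, (φ (X i) - ψ (X i)) * D i = φ p - ψ p := by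
  classical
  refine DL_induct (P := fun p e => ∃ D : σ → MvPolynomial τ R, (∀ i, DL (D i) (e - 1)) ∧
      ∑ i, (φ (X i) - ψ (X i)) * D i = φ p - ψ p) ?_ ?_ ?_ ?_ hp
  · intro e; exact ⟨0, fun i => DL_zero _, by simp⟩
  · rintro p q e ⟨D, hD, h⟩ ⟨D', hD', h'⟩
    refine ⟨D + D', fun i => (hD i).add (hD' i), ?_⟩
    simp only [Pi.add_apply, mul_add, Finset.sum_add_distrib, h, h', map_add]
    ring
  · intro a e he
    have h1 : φ (C a) = C a := φ.commutes a
    have h2 : ψ (C a) = C a := ψ.commutes a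
    exact ⟨0, fun i => DL_zero _, by simp [h1, h2]⟩
  · rintro p i e hp ⟨D, hD, h⟩
    refine ⟨fun j => ψ (X i) * D j + (if j = i then φ p else 0), fun j => ?_, ?_⟩
    · refine DL.add (((hψ i).mul (hD j)).mono (by omega)) ?_
      split_ifs
      · exact DL_hom φ hφ hp
      · exact DL_zero _
    · simp only [mul_add, Finset.sum_add_distrib, mul_ite, mul_zero, Finset.sum_ite_eq',
        Finset.mem_univ, if_true, map_mul]
      have : ∑ j, (φ (X j) - ψ (X j)) * (ψ (X i) * D j)
          = ψ (X i) * ∑ j, (φ (X j) - ψ (X j)) * D j := by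
        rw [Finset.mul_sum]; exact Finset.sum_congr rfl fun j _ => by ring
      rw [this, h]; ring

/-- `z_k = x_k - y_k`. -/
def zz (k : Fin n) : MvPolynomial (Fin n ⊕ Fin n) R := X (Sum.inl k) - X (Sum.inr k)

lemma zz_cancel (k : Fin n) {p : MvPolynomial (Fin n ⊕ Fin n) R} (h : zz k * p = 0) : p = 0 := by
  let φ : MvPolynomial (Fin n ⊕ Fin n) R →ₐ[R] MvPolynomial (Fin n ⊕ Fin n) R :=
    aeval (Sum.elim (fun k => X (Sum.inl k) + X (Sum.inr k)) (fun k => X (Sum.inr k)))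
  let ψ : MvPolynomial (Fin n ⊕ Fin n) R →ₐ[R] MvPolynomial (Fin n ⊕ Fin n) R :=
    aeval (Sum.elim (fun k => X (Sum.inl k) - X (Sum.inr k)) (fun k => X (Sum.inr k)))
  have hc : ψ.comp φ = AlgHom.id R _ := by
    apply MvPolynomial.algHom_ext
    rintro (i | i) <;> simp [φ, ψ]
  have h1 : X (Sum.inl k) * φ p = X (Sum.inl k) * 0 := by
    have := congrArg φ h
    rw [map_mul, map_zero] at this
    rw [mul_zero, ← this]
    congr 1
    simp [φ, zz]
  have h2 : φ p = 0 := (X_mul_cancel_left_iff).mp h1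
  have h3 : ψ (φ p) = p := DFunLike.congr_fun hc p
  rw [← h3, h2, map_zero]

/-- substitution `x_l ↦ y_l`. -/
def subl (l : Fin n) : MvPolynomial (Fin n ⊕ Fin n) R →ₐ[R] MvPolynomial (Fin n ⊕ Fin n) R :=
  aeval (fun i => if i = Sum.inl l then X (Sum.inr l) else X i)

lemma subl_DL (l : Fin n) (i : Fin n ⊕ Fin n) :
    DL (subl l (X i) : MvPolynomial (Fin n ⊕ Fin n) R) 1 := by
  unfold subl
  rw [aeval_X]
  split_ifs <;> exact DL_X _

lemma subl_zz_self (l : Fin n) : subl l (zz l : MvPolynomial (Fin n ⊕ Fin n) R) = 0 := by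
  simp [subl, zz]

lemma subl_zz_ne {k l : Fin n} (h : k ≠ l) :
    subl l (zz k : MvPolynomial (Fin n ⊕ Fin n) R) = zz k := by
  simp [subl, zz, h]

lemma exists_quot (l : Fin n) {p : MvPolynomial (Fin n ⊕ Fin n) R} {e : ℤ} (hp : DL p e) :
    ∃ q, DL q (e - 1) ∧ p = subl l p + zz l * q := by
  obtain ⟨D, hD, h⟩ := exists_diff (AlgHom.id R _) (subl l) (fun i => DL_X i) (subl_DL l) hp
  refine ⟨D (Sum.inl l), hD _, ?_⟩
  rw [Finset.sum_eq_single (Sum.inl l)] at h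
  · have h2 : (AlgHom.id R _) (X (Sum.inl l)) - subl l (X (Sum.inl l))
      = (zz l : MvPolynomial (Fin n ⊕ Fin n) R) := by simp [subl, zz]
    rw [h2] at h
    rw [h]; simp
  · intro i _ hi
    simp [subl, hi]
  · simp

/-- Koszul vector. -/
def kos (k l : Fin n) (c : MvPolynomial (Fin n ⊕ Fin n) R) :
    Fin n → MvPolynomial (Fin n ⊕ Fin n) R :=
  Pi.single k (c * zz l) - Pi.single l (c * zz k)

lemma koszul (S : AddSubmonoid (Fin n → MvPolynomial (Fin n ⊕ Fin n) R)) (e : ℤ)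
    (hS : ∀ k l c, k ≠ l → DL c (e - 1) → kos k l c ∈ S) (K : Finset (Fin n)) :
    ∀ D : Fin n → MvPolynomial (Fin n ⊕ Fin n) R, (∀ k ∉ K, D k = 0) → (∀ k, DL (D k) e) →
      ∑ k, zz k * D k = 0 → D ∈ S := by
  classical
  induction K using Finset.induction_on with
  | empty =>
    intro D h _ _
    have : D = 0 := funext fun k => h k (by simp)
    rw [this]; exact S.zero_mem
  | insert l K hl ih =>
    intro D h hD hsum
    choose q hq hq' using fun k => exists_quot l (hD k)
    let D0 : Fin n → MvPolynomial (Fin n ⊕ Fin n) R := fun k => if k = l then 0 else subl l (D k)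
    have hD0 : D0 ∈ S := by
      apply ih
      · intro k hk
        by_cases hkl : k = l
        · simp [D0, hkl]
        · simp [D0, hkl, h k (by simp [hk, hkl])]
      · intro k
        by_cases hkl : k = l
        · simpa [D0, hkl] using DL_zero _
        · simpa [D0, hkl] using DL_hom _ (subl_DL l) (hD k)
      · have := congrArg (subl l) hsum
        rw [map_sum, map_zero] at this
        rw [← this]
        refine Finset.sum_congr rfl fun k _ => ?_
        rw [map_mul]
        by_cases hkl : k = l
        · subst hkl; simp [D0, subl_zz_self]
        · simp [D0, hkl, subl_zz_ne hkl]
    have hl' : D l + ∑ k ∈ univ.erase l, zz k * q k = 0 := by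
      apply zz_cancel l
      have h0 : ∑ k ∈ univ.erase l, zz k * subl l (D k) = 0 := by
        have := congrArg (subl l) hsum
        rw [map_sum, map_zero, ← Finset.add_sum_erase _ _ (Finset.mem_univ l), map_mul,
          subl_zz_self, zero_mul, zero_add] at this
        rw [← this]
        refine Finset.sum_congr rfl fun k hk => ?_
        rw [map_mul, subl_zz_ne (Finset.ne_of_mem_erase hk)]
      rw [← Finset.add_sum_erase _ _ (Finset.mem_univ l)] at hsum
      have h1 : ∑ k ∈ univ.erase l, zz k * D k =
          ∑ k ∈ univ.erase l, zz k * subl l (D k) + zz l * ∑ k ∈ univ.erase l, zz k * q k := by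
        rw [Finset.mul_sum, ← Finset.sum_add_distrib]
        refine Finset.sum_congr rfl fun k _ => ?_
        conv_lhs => rw [hq' k]
        ring
      rw [h1, h0, zero_add] at hsum
      rw [mul_add]; exact hsum
    have : D = D0 + ∑ k ∈ univ.erase l, kos k l (q k) := by
      funext j
      rw [Pi.add_apply, Finset.sum_apply]
      by_cases hj : j = l
      · subst hj
        rw [eq_neg_of_add_eq_zero_left hl', ← Finset.sum_neg_distrib]
        simp only [D0, if_true, zero_add]
        refine Finset.sum_congr rfl fun k hk => ?_
        have := Finset.ne_of_mem_erase hk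
        simp [kos, Pi.single_eq_of_ne this.symm]
        ring
      · rw [Finset.sum_eq_single j]
        · simp only [D0, hj, if_false]
          conv_lhs => rw [hq' j]
          simp [kos, Pi.single_eq_of_ne hj]
          ring
        · intro k _ hk
          simp [kos, Pi.single_eq_of_ne hj, Pi.single_eq_of_ne hk.symm]
        · intro hj'; simp [hj] at hj'
    rw [this]
    refine S.add_mem hD0 (S.sum_mem fun k hk => hS k l (q k) (Finset.ne_of_mem_erase hk) (hq k))

/-- The bilinear functional `L₁(x) L₂(y)`. -/
def Lam (L₁ L₂ : MvPolynomial (Fin n) R →ₗ[R] R) : MvPolynomial (Fin n ⊕ Fin n) R →ₗ[R] R :=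
  (basisMonomials (Fin n ⊕ Fin n) R).constr R fun m =>
    L₁ (monomial (Finsupp.sumFinsuppAddEquivProdFinsupp m).1 1) *
      L₂ (monomial (Finsupp.sumFinsuppAddEquivProdFinsupp m).2 1)

lemma monomial_eq_smul_one (m : σ →₀ ℕ) (c : R) :
    (monomial m c : MvPolynomial σ R) = c • monomial m 1 := by
  rw [smul_monomial, smul_eq_mul, mul_one]

lemma Lam_monomial (L₁ L₂ : MvPolynomial (Fin n) R →ₗ[R] R) (m : Fin n ⊕ Fin n →₀ ℕ) (c : R) :
    Lam L₁ L₂ (monomial m c) = c * (L₁ (monomial (Finsupp.sumFinsuppAddEquivProdFinsupp m).1 1) *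
      L₂ (monomial (Finsupp.sumFinsuppAddEquivProdFinsupp m).2 1)) := by
  have h : Lam L₁ L₂ (monomial m 1) = (L₁ (monomial (Finsupp.sumFinsuppAddEquivProdFinsupp m).1 1) *
      L₂ (monomial (Finsupp.sumFinsuppAddEquivProdFinsupp m).2 1)) := by
    have := (basisMonomials (Fin n ⊕ Fin n) R).constr_basis R (fun m =>
      L₁ (monomial (Finsupp.sumFinsuppAddEquivProdFinsupp m).1 1) *
      L₂ (monomial (Finsupp.sumFinsuppAddEquivProdFinsupp m).2 1)) m
    rw [coe_basisMonomials] at this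
    exact this
  rw [monomial_eq_smul_one, map_smul, h, smul_eq_mul]

lemma Lam_eq (L₁ L₂ : MvPolynomial (Fin n) R →ₗ[R] R) (P : MvPolynomial (Fin n ⊕ Fin n) R) :
    L₁ (applyY L₂ P) = Lam L₁ L₂ P := by
  conv_rhs => rw [P.as_sum]
  unfold applyY
  rw [map_sum, map_sum]
  refine Finset.sum_congr rfl fun m _ => ?_
  rw [Lam_monomial, ← smul_eq_C_mul, map_smul, smul_eq_mul]
  ring

lemma split_fst (s t : Fin n →₀ ℕ) : (Finsupp.sumFinsuppAddEquivProdFinsupp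
    (Finsupp.mapDomain Sum.inl s + Finsupp.mapDomain Sum.inr t)).1 = s := by
  ext i
  rw [Finsupp.fst_sumFinsuppAddEquivProdFinsupp, Finsupp.add_apply,
    Finsupp.mapDomain_apply Sum.inl_injective, Finsupp.mapDomain_of_notMem_range _ _ (by simp), add_zero]

lemma split_snd (s t : Fin n →₀ ℕ) : (Finsupp.sumFinsuppAddEquivProdFinsupp
    (Finsupp.mapDomain Sum.inl s + Finsupp.mapDomain Sum.inr t)).2 = t := by
  ext i
  rw [Finsupp.snd_sumFinsuppAddEquivProdFinsupp, Finsupp.add_apply,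
    Finsupp.mapDomain_apply Sum.inr_injective, Finsupp.mapDomain_of_notMem_range _ _ (by simp), zero_add]

lemma split_eq (m : Fin n ⊕ Fin n →₀ ℕ) :
    Finsupp.mapDomain Sum.inl (Finsupp.sumFinsuppAddEquivProdFinsupp m).1 +
      Finsupp.mapDomain Sum.inr (Finsupp.sumFinsuppAddEquivProdFinsupp m).2 = m := by
  apply Finsupp.sumFinsuppAddEquivProdFinsupp.injective
  exact Prod.ext (split_fst _ _) (split_snd _ _)

lemma toX_mul_toY_monomial (s t : Fin n →₀ ℕ) (a b : R) :
    toX (monomial s a) * toY (monomial t b) =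
      monomial (Finsupp.mapDomain Sum.inl s + Finsupp.mapDomain Sum.inr t) (a * b) := by
  unfold toX toY
  rw [rename_monomial, rename_monomial, monomial_mul]

lemma Lam_mul (L₁ L₂ : MvPolynomial (Fin n) R →ₗ[R] R) (p q : MvPolynomial (Fin n) R) :
    Lam L₁ L₂ (toX p * toY q) = L₁ p * L₂ q := by
  induction p using MvPolynomial.induction_on' with
  | add p p' h h' => rw [map_add, add_mul, map_add, h, h', map_add, add_mul]
  | monomial s a =>
    induction q using MvPolynomial.induction_on' with
    | add p p' h h' => rw [map_add, mul_add, map_add, h, h', map_add, mul_add]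
    | monomial t b =>
      rw [toX_mul_toY_monomial, Lam_monomial, split_fst, split_snd, monomial_eq_smul_one s a,
        monomial_eq_smul_one t b, map_smul, map_smul, smul_eq_mul, smul_eq_mul]
      ring

lemma annul_mul {f : Fin n → MvPolynomial (Fin n) R} {L : MvPolynomial (Fin n) R →ₗ[R] R} {d : ℤ}
    (hL : Annuls L (boundedSpan f (d : WithBot ℤ))) (i : Fin n) (s : Fin n →₀ ℕ) (c : R)
    (h : ((f i).totalDegree : ℤ) + (Finsupp.degree s : ℕ) ≤ d) : L (f i * monomial s c) = 0 := by
  classical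
  apply hL
  refine ⟨Pi.single i (monomial s c), ?_, ?_⟩
  · rw [Finset.sum_eq_single i]
    · simp
    · intro j _ hj; simp [Pi.single_eq_of_ne hj]
    · simp
  · intro j
    by_cases hj : j = i
    · subst hj
      rw [Pi.single_eq_same]
      have h1 := (mdeg_le_iff _ _).mpr (DL_totalDegree (f j))
      have h2 : mdeg (monomial s c) ≤ (((Finsupp.degree s : ℕ) : ℤ) : WithBot ℤ) := by
        rw [mdeg_le_iff]
        intro m hm
        rw [coeff_monomial] at hm
        have : s = m := by by_contra h; simp [h] at hm
        rw [this]
      refine (add_le_add h1 h2).trans ?_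
      exact_mod_cast h
    · rw [Pi.single_eq_of_ne hj]
      have : mdeg (0 : MvPolynomial (Fin n) R) = ⊥ := by simp [mdeg]
      rw [this, WithBot.add_bot]
      exact bot_le

lemma Lam_kill {f : Fin n → MvPolynomial (Fin n) R} {L₁ L₂ : MvPolynomial (Fin n) R →ₗ[R] R}
    {d₁ d₂ : ℤ} (h₁ : Annuls L₁ (boundedSpan f (d₁ : WithBot ℤ)))
    (h₂ : Annuls L₂ (boundedSpan f (d₂ : WithBot ℤ))) (i j : Fin n)
    (q : MvPolynomial (Fin n ⊕ Fin n) R)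
    (hq : DL q (d₁ + d₂ + 1 - (f i).totalDegree - (f j).totalDegree)) :
    Lam L₁ L₂ (toX (f i) * toY (f j) * q) = 0 := by
  rw [q.as_sum, Finset.mul_sum, map_sum]
  refine Finset.sum_eq_zero fun m hm => ?_
  have hm' := hq m (by simpa using hm)
  generalize coeff m q = c
  have e := split_eq m
  generalize (Finsupp.sumFinsuppAddEquivProdFinsupp m).1 = s at e
  generalize (Finsupp.sumFinsuppAddEquivProdFinsupp m).2 = t at e
  subst e
  have hd : Finsupp.degree (Finsupp.mapDomain (Sum.inl : Fin n → Fin n ⊕ Fin n) s +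
      Finsupp.mapDomain Sum.inr t) = Finsupp.degree s + Finsupp.degree t := by
    rw [map_add]; simp
  rw [hd] at hm'
  push_cast at hm'
  have : toX (f i) * toY (f j) * monomial (Finsupp.mapDomain (Sum.inl : Fin n → Fin n ⊕ Fin n) s +
      Finsupp.mapDomain Sum.inr t) c = toX (f i * monomial s c) * toY (f j * monomial t 1) := by
    rw [map_mul, map_mul, mul_mul_mul_comm, toX_mul_toY_monomial, mul_one]
  rw [this, Lam_mul]
  by_cases h : ((f i).totalDegree : ℤ) + (Finsupp.degree s : ℕ) ≤ d₁
  · rw [annul_mul h₁ i s c h, zero_mul]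
  · rw [annul_mul h₂ j t 1 (by omega), mul_zero]

/-- bordered matrix -/
def bm {S : Type*} (A : Fin n → Fin n → S) (r : Fin n → S) (v : Fin (n + 1) → S) :
    Matrix (Fin (n + 1)) (Fin (n + 1)) S :=
  Matrix.of fun k i => Fin.lastCases (motive := fun _ => S) (v k)
    (fun i' => Fin.lastCases (motive := fun _ => S) (r i') (fun k' => A i' k') k) i

section bm
variable {S : Type*} (A : Fin n → Fin n → S) (r : Fin n → S) (v : Fin (n + 1) → S)
@[simp] lemma bm_last (k) : bm A r v k (Fin.last n) = v k := by simp [bm]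
@[simp] lemma bm_cl (i : Fin n) : bm A r v (Fin.last n) i.castSucc = r i := by simp [bm]
@[simp] lemma bm_cc (i k : Fin n) : bm A r v k.castSucc i.castSucc = A i k := by simp [bm]

/-- extended column -/
def ext1 (w : Fin n → S) (c : S) : Fin (n + 1) → S := Fin.snoc (α := fun _ => S) w c
@[simp] lemma ext1_last (w : Fin n → S) (c : S) : ext1 w c (Fin.last n) = c := by simp [ext1]
@[simp] lemma ext1_cast (w : Fin n → S) (c : S) (k : Fin n) : ext1 w c k.castSucc = w k := by
  simp [ext1]

lemma bm_eq_updateCol (v' : Fin (n + 1) → S) :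
    bm A r v = (bm A r v').updateCol (Fin.last n) v := by
  ext k i
  refine Fin.lastCases ?_ (fun i => ?_) i
  · simp
  · rw [Matrix.updateCol_ne (Fin.castSucc_lt_last i).ne]
    refine Fin.lastCases ?_ (fun k => ?_) k <;> simp
end bm

lemma ddetX_eq (f : Fin n → MvPolynomial (Fin n) R)
    (Df : Fin n → Fin n → MvPolynomial (Fin n ⊕ Fin n) R)
    (F : MvPolynomial (Fin n) R) (DF : Fin n → MvPolynomial (Fin n ⊕ Fin n) R) :
    ddetX f Df F DF = (bm Df (fun i => toX (f i)) (ext1 DF (toX F))).det := by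
  unfold ddetX
  congr 1
  ext1 k i
  refine Fin.lastCases ?_ (fun i => ?_) i <;> refine Fin.lastCases ?_ (fun k => ?_) k <;> simp

/-- determinant as a linear function of the last column -/
def colDet {S : Type*} [CommRing S] (A : Fin n → Fin n → S) (r : Fin n → S) :
    (Fin (n + 1) → S) →ₗ[S] S where
  toFun v := (bm A r v).det
  map_add' u v := by
    rw [bm_eq_updateCol A r (u + v) 0, Matrix.det_updateCol_add, ← bm_eq_updateCol,
      ← bm_eq_updateCol]
  map_smul' s v := by
    rw [bm_eq_updateCol A r (s • v) 0, Matrix.det_updateCol_smul, ← bm_eq_updateCol]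
    rfl

lemma colDet_col {S : Type*} [CommRing S] (A : Fin n → Fin n → S) (r : Fin n → S) (i : Fin n) :
    colDet A r (ext1 (A i) (r i)) = 0 := by
  refine Matrix.det_zero_of_column_eq (Fin.castSucc_lt_last i).ne fun k => ?_
  refine Fin.lastCases ?_ (fun k => ?_) k <;> simp

lemma kos_det (A : Fin n → Fin n → MvPolynomial (Fin n ⊕ Fin n) R)
    (r r' : Fin n → MvPolynomial (Fin n ⊕ Fin n) R)
    (hA : ∀ i, ∑ k, zz k * A i k = r i - r' i) (k l : Fin n) (hkl : k ≠ l)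
    (c : MvPolynomial (Fin n ⊕ Fin n) R) :
    colDet A r (ext1 (kos k l c) 0) =
      ((bm A r (ext1 (Pi.single l c) 0)).updateRow k.castSucc (ext1 r' 0)).det := by
  set M := bm A r (ext1 (kos k l c) 0) with hM
  set v := ext1 (Pi.single l c) (0 : MvPolynomial (Fin n ⊕ Fin n) R) with hv
  have h := Matrix.det_updateRow_sum M k.castSucc (ext1 zz (-1))
  have hrow : ∑ m, (ext1 zz (-1) : Fin (n + 1) → MvPolynomial (Fin n ⊕ Fin n) R) m • M m
      = (-1 : MvPolynomial (Fin n ⊕ Fin n) R) • ext1 r' 0 := by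
    funext i
    rw [Finset.sum_apply, Fin.sum_univ_castSucc]
    refine Fin.lastCases ?_ (fun i => ?_) i
    · simp only [hM, Pi.smul_apply, ext1_cast, ext1_last, bm_last, smul_eq_mul, mul_zero, add_zero]
      simp only [kos, Pi.sub_apply, mul_sub, Finset.sum_sub_distrib]
      simp [Pi.single_apply]
      ring
    · simp only [hM, Pi.smul_apply, ext1_cast, ext1_last, bm_cc, bm_cl, smul_eq_mul, hA]
      ring
  have hmat : M.updateRow k.castSucc (ext1 r' 0) =
      ((bm A r v).updateRow k.castSucc (ext1 r' 0)).updateCol (Fin.last n)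
        ((-zz k : MvPolynomial (Fin n ⊕ Fin n) R) • v) := by
    ext1 m i
    refine Fin.lastCases ?_ (fun i => ?_) i
    · rw [Matrix.updateCol_self]
      refine Fin.lastCases ?_ (fun m => ?_) m
      · rw [Matrix.updateRow_ne (Fin.castSucc_lt_last k).ne']
        simp [hM, hv]
      · by_cases hm : m = k
        · subst hm
          simp [hv, Pi.single_eq_of_ne hkl]
        · rw [Matrix.updateRow_ne (by simpa using hm)]
          simp [hM, hv, kos, Pi.single_eq_of_ne hm]
          by_cases hl : m = l
          · subst hl; simp; ring
          · simp [Pi.single_eq_of_ne hl]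
    · rw [Matrix.updateCol_ne (Fin.castSucc_lt_last i).ne]
      by_cases hm : m = k.castSucc
      · subst hm; simp
      · rw [Matrix.updateRow_ne hm, Matrix.updateRow_ne hm]
        refine Fin.lastCases ?_ (fun m => ?_) m <;> simp [hM]
  have hself : ((bm A r v).updateRow k.castSucc (ext1 r' 0)).updateCol (Fin.last n) v =
      (bm A r v).updateRow k.castSucc (ext1 r' 0) := by
    ext1 m i
    refine Fin.lastCases ?_ (fun i => ?_) i
    · rw [Matrix.updateCol_self]
      by_cases hm : m = k.castSucc
      · subst hm; simp [hv, Pi.single_eq_of_ne hkl]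
      · rw [Matrix.updateRow_ne hm]; simp
    · rw [Matrix.updateCol_ne (Fin.castSucc_lt_last i).ne]
  rw [hrow, Matrix.det_updateRow_smul, hmat, Matrix.det_updateCol_smul, hself, ext1_cast,
    smul_eq_mul] at h
  have h0 : zz k * (M.det - ((bm A r v).updateRow k.castSucc (ext1 r' 0)).det) = 0 := by
    rw [mul_sub, ← h]; ring
  exact sub_eq_zero.mp (zz_cancel k h0)

section kill
variable (f : Fin n → MvPolynomial (Fin n) R) (Λ : MvPolynomial (Fin n ⊕ Fin n) R →ₗ[R] R)
  (d : Fin n → ℤ) (e : ℤ) (A : Fin n → Fin n → MvPolynomial (Fin n ⊕ Fin n) R)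

lemma kill_det (M : Matrix (Fin (n + 1)) (Fin (n + 1)) (MvPolynomial (Fin n ⊕ Fin n) R))
    (h : ∀ σ : Equiv.Perm (Fin (n + 1)), Λ (∏ i, M (σ i) i) = 0) : Λ M.det = 0 := by
  rw [Matrix.det_apply, map_sum]
  refine Finset.sum_eq_zero fun σ _ => ?_
  rw [Units.smul_def, map_zsmul, h, smul_zero]

lemma kill_T1
    (hΛ : ∀ i j q, DL q (∑ i, (d i - 1) + e - d i - d j) → Λ (toX (f i) * toY (f j) * q) = 0)
    (hA : ∀ i k, DL (A i k) (d i - 1)) (i : Fin n)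
    (w : Fin n → MvPolynomial (Fin n ⊕ Fin n) R) (hw : ∀ k, DL (w k) (e - d i - 1)) :
    Λ (colDet A (fun i => toX (f i)) (ext1 (fun k => toY (f i) * w k) 0)) = 0 := by
  refine kill_det Λ _ fun σ => ?_
  rw [Fin.prod_univ_castSucc, bm_last]
  obtain ⟨j0, hj0⟩ := σ.surjective (Fin.last n)
  rcases Fin.eq_castSucc_or_eq_last j0 with ⟨j, rfl⟩ | rfl
  · rw [← Finset.mul_prod_erase _ _ (Finset.mem_univ j), hj0, bm_cl]
    obtain ⟨k, hk⟩ : ∃ k : Fin n, σ (Fin.last n) = k.castSucc := by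
      rcases Fin.eq_castSucc_or_eq_last (σ (Fin.last n)) with ⟨k, hk⟩ | hk
      · exact ⟨k, hk⟩
      · exact absurd (σ.injective (hk.trans hj0.symm)) (Fin.castSucc_lt_last j).ne'
    rw [hk, ext1_cast]
    have hP : DL (∏ x ∈ univ.erase j, bm A (fun i => toX (f i))
        (ext1 (fun k => toY (f i) * w k) 0) (σ x.castSucc) x.castSucc)
        (∑ x ∈ univ.erase j, (d x - 1)) := by
      refine DL_prod _ _ _ fun x hx => ?_
      rcases Fin.eq_castSucc_or_eq_last (σ x.castSucc) with ⟨k, hk⟩ | hk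
      · rw [hk, bm_cc]; exact hA x k
      · rw [← hj0] at hk
        exact absurd (Fin.castSucc_injective n (σ.injective hk)) (Finset.ne_of_mem_erase hx)
    have hs := Finset.add_sum_erase univ (fun x => d x - 1) (Finset.mem_univ j)
    have := hΛ j i _ ((hP.mul (hw k)).mono (e' := ∑ i, (d i - 1) + e - d j - d i) (by
      rw [← hs]; linarith))
    refine Eq.trans (congrArg Λ ?_) this
    generalize ∏ x ∈ univ.erase j, bm A (fun i => toX (f i))
        (ext1 (fun k => toY (f i) * w k) 0) (σ x.castSucc) x.castSucc = P
    ring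
  · rw [hj0, ext1_last, mul_zero, map_zero]

lemma kill_T2
    (hΛ : ∀ i j q, DL q (∑ i, (d i - 1) + e - d i - d j) → Λ (toX (f i) * toY (f j) * q) = 0)
    (hA : ∀ i k, DL (A i k) (d i - 1)) (k : Fin n)
    (v : Fin n → MvPolynomial (Fin n ⊕ Fin n) R) (hv : ∀ m, DL (v m) (e - 2)) :
    Λ (((bm A (fun i => toX (f i)) (ext1 v 0)).updateRow k.castSucc
      (ext1 (fun i => toY (f i)) 0)).det) = 0 := by
  refine kill_det Λ _ fun σ => ?_
  rw [Fin.prod_univ_castSucc]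
  set M := (bm A (fun i => toX (f i)) (ext1 v 0)).updateRow k.castSucc
      (ext1 (fun i => toY (f i)) 0) with hM
  have hMl : ∀ i, M (Fin.last n) i = bm A (fun i => toX (f i)) (ext1 v 0) (Fin.last n) i := by
    intro i; rw [hM, Matrix.updateRow_ne (Fin.castSucc_lt_last k).ne']
  have hMk : ∀ i, M k.castSucc i = ext1 (fun i => toY (f i)) 0 i := by
    intro i; rw [hM, Matrix.updateRow_self]
  have hMm : ∀ m i, m ≠ k → M m.castSucc i =
      bm A (fun i => toX (f i)) (ext1 v 0) m.castSucc i := by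
    intro m i h; rw [hM, Matrix.updateRow_ne (by simpa using h)]
  obtain ⟨j0, hj0⟩ := σ.surjective (Fin.last n)
  obtain ⟨i0, hi0⟩ := σ.surjective k.castSucc
  rcases Fin.eq_castSucc_or_eq_last j0 with ⟨j, rfl⟩ | rfl
  swap
  · rw [hj0, hMl, bm_last, ext1_last, mul_zero, map_zero]
  rcases Fin.eq_castSucc_or_eq_last i0 with ⟨i, rfl⟩ | rfl
  swap
  · rw [hi0, hMk, ext1_last, mul_zero, map_zero]
  have hij : i ≠ j := by
    rintro rfl
    rw [hi0] at hj0
    exact absurd hj0 (Fin.castSucc_lt_last k).ne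
  have hi : i ∈ univ.erase j := by simp [hij]
  rw [← Finset.mul_prod_erase _ _ (Finset.mem_univ j), ← Finset.mul_prod_erase _ _ hi, hj0, hi0,
    hMl, hMk, bm_cl, ext1_cast]
  have hlast : DL (M (σ (Fin.last n)) (Fin.last n)) (e - 2) := by
    rcases Fin.eq_castSucc_or_eq_last (σ (Fin.last n)) with ⟨m, hm⟩ | hm
    · by_cases hmk : m = k
      · rw [hm, hmk, hMk, ext1_last]; exact DL_zero _
      · rw [hm, hMm _ _ hmk, bm_last, ext1_cast]; exact hv m
    · rw [hm, hMl, bm_last, ext1_last]; exact DL_zero _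
  have hP : DL (∏ x ∈ (univ.erase j).erase i, M (σ x.castSucc) x.castSucc)
      (∑ x ∈ (univ.erase j).erase i, (d x - 1)) := by
    refine DL_prod _ _ _ fun x hx => ?_
    have hxi := Finset.ne_of_mem_erase hx
    have hxj := Finset.ne_of_mem_erase (Finset.mem_of_mem_erase hx)
    rcases Fin.eq_castSucc_or_eq_last (σ x.castSucc) with ⟨m, hm⟩ | hm
    · by_cases hmk : m = k
      · rw [hmk, ← hi0] at hm
        exact absurd (Fin.castSucc_injective n (σ.injective hm)) hxi
      · rw [hm, hMm _ _ hmk, bm_cc]; exact hA x m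
    · rw [← hj0] at hm
      exact absurd (Fin.castSucc_injective n (σ.injective hm)) hxj
  have hs := Finset.add_sum_erase univ (fun x => d x - 1) (Finset.mem_univ j)
  have hs' := Finset.add_sum_erase _ (fun x => d x - 1) hi
  have := hΛ j i _ ((hP.mul hlast).mono (e' := ∑ i, (d i - 1) + e - d j - d i) (by
    rw [← hs, ← hs']; linarith))
  refine Eq.trans (congrArg Λ ?_) this
  generalize ∏ x ∈ (univ.erase j).erase i, M (σ x.castSucc) x.castSucc = P
  generalize M (σ (Fin.last n)) (Fin.last n) = Q
  ring
end kill
end helpers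

/-- Theorem 3.2: the extended functional
`F ↦ L₁(x_*).L₂(y_*).det‖∇f ∇F; f(x) F(x)‖` annuls `(f)^{≤ δ_f + δ₁ + δ₂ + 1}_x`. -/
theorem extension_annuls {R : Type*} [CommRing R] {n : ℕ}
    (f : Fin n → MvPolynomial (Fin n) R) (hf : ∀ i, (1 : WithBot ℤ) ≤ mdeg (f i))
    (δ₁ δ₂ : ℤ) (hδ₁ : 0 ≤ δ₁) (hδ₂ : 0 ≤ δ₂)
    (L₁ L₂ : MvPolynomial (Fin n) R →ₗ[R] R)
    (hL₁ : Annuls L₁ (boundedSpan f ((deltaF f + δ₁ : ℤ) : WithBot ℤ)))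
    (hL₂ : Annuls L₂ (boundedSpan f ((deltaF f + δ₂ : ℤ) : WithBot ℤ)))
    (Df : Fin n → Fin n → MvPolynomial (Fin n ⊕ Fin n) R)
    (hDf : ∀ i, IsDiffDeriv (f i) (Df i) ∧ IsMonotonous (f i) (Df i))
    (F : MvPolynomial (Fin n) R)
    (hF : F ∈ boundedSpan f ((deltaF f + δ₁ + δ₂ + 1 : ℤ) : WithBot ℤ))
    (DF : Fin n → MvPolynomial (Fin n ⊕ Fin n) R)
    (hDF : IsDiffDeriv F DF ∧ IsMonotonous F DF) :
    L₁ (applyY L₂ (ddetX f Df F DF)) = 0 := by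
  classical
  rw [Lam_eq, ddetX_eq]
  set d : Fin n → ℤ := fun i => ((f i).totalDegree : ℤ) with hd
  set e : ℤ := deltaF f + δ₁ + δ₂ + 1 with he
  set A := Df with hAdef
  set r : Fin n → MvPolynomial (Fin n ⊕ Fin n) R := fun i => toX (f i) with hr
  have hδ : deltaF f = ∑ i, (d i - 1) := rfl
  have hf0 : ∀ i, f i ≠ 0 := by
    intro i h
    have := hf i
    rw [h] at this
    simp [mdeg] at this
  have hmd : ∀ i, mdeg (f i) = ((d i : ℤ) : WithBot ℤ) := fun i => mdeg_eq (hf0 i)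
  have hΛ : ∀ i j q, DL q (∑ i, (d i - 1) + e - d i - d j) →
      Lam L₁ L₂ (toX (f i) * toY (f j) * q) = 0 := by
    intro i j q hq
    refine Lam_kill hL₁ hL₂ i j q (hq.mono ?_)
    rw [← hδ, he]
    simp only [hd]
    linarith
  have hpred : ∀ (p : MvPolynomial (Fin n ⊕ Fin n) R) (m : WithBot ℤ) (c : ℤ),
      mdeg p + 1 ≤ m → m ≤ (c : WithBot ℤ) → DL p (c - 1) := by
    intro p m c h1 h2
    rw [← mdeg_le_iff]
    have h3 := h1.trans h2
    cases hp : mdeg p with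
    | bot => exact bot_le
    | coe a =>
      rw [hp] at h3
      have h4 : a + 1 ≤ c := by exact_mod_cast h3
      exact_mod_cast (by omega : a ≤ c - 1)
  have hA : ∀ i k, DL (A i k) (d i - 1) := fun i k =>
    hpred _ _ _ ((hDf i).2 k) (hmd i).le
  obtain ⟨g, hFg, hg⟩ := hF
  have hgD : ∀ i, DL (g i) (e - d i) := by
    intro i
    have h := hg i
    rw [← mdeg_le_iff]
    rw [hmd] at h
    cases hp : mdeg (g i) with
    | bot => exact bot_le
    | coe a =>
      rw [hp] at h
      have h4 : d i + a ≤ e := by exact_mod_cast h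
      exact_mod_cast (by omega : a ≤ e - d i)
  have hFD : DL F e := by
    rw [hFg]
    refine DL_sum _ _ _ fun i _ => ?_
    exact ((DL_totalDegree (f i)).mul (hgD i)).mono (by simp [hd])
  have hDFD : ∀ k, DL (DF k) (e - 1) := fun k =>
    hpred _ _ _ (hDF.2 k) ((mdeg_le_iff _ _).mpr hFD)
  have hXd : ∀ i, DL (toX (X i) : MvPolynomial (Fin n ⊕ Fin n) R) 1 := by
    intro i; simpa [toX] using DL_X _
  have hYd : ∀ i, DL (toY (X i) : MvPolynomial (Fin n ⊕ Fin n) R) 1 := by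
    intro i; simpa [toY] using DL_X _
  choose G hG hG' using fun i => exists_diff toX toY hXd hYd (hgD i)
  have hzz : ∀ k : Fin n, (toX (X k) - toY (X k) : MvPolynomial (Fin n ⊕ Fin n) R) = zz k := by
    intro k; simp [toX, toY, zz]
  simp only [hzz] at hG'
  have hAz : ∀ i, ∑ k, zz k * A i k = r i - toY (f i) := fun i => (hDf i).1
  have hFz : ∑ k, zz k * DF k = toX F - toY F := hDF.1
  set D : Fin n → MvPolynomial (Fin n ⊕ Fin n) R := fun k =>
    DF k - ∑ i, (toX (g i) * A i k + toY (f i) * G i k) with hDdef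
  have hcol : ext1 DF (toX F) = ext1 D 0 + (∑ i, ext1 (fun k => toY (f i) * G i k) 0 +
      ∑ i, toX (g i) • ext1 (A i) (r i)) := by
    funext k
    refine Fin.lastCases ?_ (fun k => ?_) k
    · simp [Finset.sum_apply, hFg, hr, mul_comm]
    · simp only [Pi.add_apply, Finset.sum_apply, ext1_cast, Pi.smul_apply, smul_eq_mul, hDdef,
        Finset.sum_add_distrib]
      ring
  have hDD : ∀ k, DL (D k) (e - 1) := by
    intro k
    refine (hDFD k).sub (DL_sum _ _ _ fun i _ => DL.add ?_ ?_)
    · exact ((DL_hom _ hXd (hgD i)).mul (hA i k)).mono (by omega)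
    · exact ((DL_hom _ hYd (DL_totalDegree (f i))).mul (hG i k)).mono (by simp only [hd]; omega)
  have hDz : ∑ k, zz k * D k = 0 := by
    have h1 : ∀ i, ∑ k, zz k * (toX (g i) * A i k + toY (f i) * G i k) =
        toX (f i) * toX (g i) - toY (f i) * toY (g i) := by
      intro i
      have : ∑ k, zz k * (toX (g i) * A i k + toY (f i) * G i k) =
          toX (g i) * ∑ k, zz k * A i k + toY (f i) * ∑ k, zz k * G i k := by
        rw [Finset.mul_sum, Finset.mul_sum, ← Finset.sum_add_distrib]
        exact Finset.sum_congr rfl fun k _ => by ring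
      rw [this, hAz, hG']
      simp only [hr]
      ring
    simp only [hDdef, mul_sub, Finset.sum_sub_distrib, Finset.mul_sum]
    rw [Finset.sum_comm, hFz, Finset.sum_congr rfl fun i _ => h1 i, hFg]
    simp [map_sum, map_mul]
  let S : AddSubmonoid (Fin n → MvPolynomial (Fin n ⊕ Fin n) R) :=
    { carrier := {w | Lam L₁ L₂ (colDet A r (ext1 w 0)) = 0}
      zero_mem' := by
        have : ext1 (0 : Fin n → MvPolynomial (Fin n ⊕ Fin n) R) 0 = 0 := by
          funext k; refine Fin.lastCases ?_ (fun k => ?_) k <;> simp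
        simp [this]
      add_mem' := by
        intro u v hu hv
        have : ext1 (u + v) 0 = ext1 u 0 + ext1 v 0 := by
          funext k; refine Fin.lastCases ?_ (fun k => ?_) k <;> simp
        simp only [Set.mem_setOf_eq] at hu hv ⊢
        rw [this, map_add, map_add, hu, hv, add_zero] }
  have hDS : D ∈ S := by
    refine koszul S (e - 1) ?_ univ D (by simp) hDD hDz
    intro k l c hkl hc
    show Lam L₁ L₂ (colDet A r (ext1 (kos k l c) 0)) = 0
    rw [kos_det A r (fun i => toY (f i)) hAz k l hkl c]
    refine kill_T2 f _ d e A hΛ hA k _ fun m => ?_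
    by_cases hm : m = l
    · subst hm; rw [Pi.single_eq_same]; exact hc.mono (by omega)
    · rw [Pi.single_eq_of_ne hm]; exact DL_zero _
  have hDS' : Lam L₁ L₂ (colDet A r (ext1 D 0)) = 0 := hDS
  show Lam L₁ L₂ (colDet A r (ext1 DF (toX F))) = 0
  rw [hcol, map_add, map_add, map_add, map_add, map_sum, map_sum, map_sum, map_sum, hDS', zero_add]
  rw [Finset.sum_eq_zero fun i _ => kill_T1 f _ d e A hΛ hA i (G i) (hG i), zero_add]
  refine Finset.sum_eq_zero fun i _ => ?_
  rw [map_smul, colDet_col, smul_zero, map_zero]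

end
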